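/- Bounded relative error of the minimax tilted estimator (Theorem 2, case 𝒥 ≠ ∅): if q_j = 0 for at least one j ∈ {1,…,d₂}, then limsup_{γ→∞} M(γ)/ℓ(γ)² < ∞, i.e., the minimax exponentially tilted importance-sampling estimator of ℓ(γ) has bounded relative error as γ → ∞. -/

import Mathlib

open MeasureTheory Real Filter Matrix

/-- Standard normal density on ℝ. -/
noncomputable def stdPdf (t : ℝ) : ℝ := (Real.sqrt (2 * Real.pi))⁻¹ * Real.exp (-t ^ 2 / 2)

/-- Standard normal cumulative distribution function Φ. -/
noncomputable def Phi (t : ℝ) : ℝ := ∫ s in Set.Iic t, stdPdf s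

/-- Standard `d`-dimensional normal density φ_d(x) = (2π)^{-d/2} exp(-‖x‖²/2). -/
noncomputable def phiD {d : ℕ} (x : Fin d → ℝ) : ℝ :=
  ((Real.sqrt (2 * Real.pi)) ^ d)⁻¹ * Real.exp (-(∑ i, x i ^ 2) / 2)

/-- Upper-left d₁×d₁ block L₁₁ of a (d₁+d₂)×(d₁+d₂) matrix. -/
def blk11 {d₁ d₂ : ℕ} (L : Matrix (Fin (d₁ + d₂)) (Fin (d₁ + d₂)) ℝ) :
    Matrix (Fin d₁) (Fin d₁) ℝ := L.submatrix (Fin.castAdd d₂) (Fin.castAdd d₂)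

/-- Lower-left d₂×d₁ block L₂₁. -/
def blk21 {d₁ d₂ : ℕ} (L : Matrix (Fin (d₁ + d₂)) (Fin (d₁ + d₂)) ℝ) :
    Matrix (Fin d₂) (Fin d₁) ℝ := L.submatrix (Fin.natAdd d₁) (Fin.castAdd d₂)

/-- Lower-right d₂×d₂ block L₂₂. -/
def blk22 {d₁ d₂ : ℕ} (L : Matrix (Fin (d₁ + d₂)) (Fin (d₁ + d₂)) ℝ) :
    Matrix (Fin d₂) (Fin d₂) ℝ := L.submatrix (Fin.natAdd d₁) (Fin.natAdd d₁)

/-- First block p₁ of a vector p ∈ ℝ^{d₁+d₂}. -/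
def vec1 {d₁ d₂ : ℕ} (p : Fin (d₁ + d₂) → ℝ) : Fin d₁ → ℝ := fun i => p (Fin.castAdd d₂ i)

/-- Second block p₂ of a vector p ∈ ℝ^{d₁+d₂}. -/
def vec2 {d₁ d₂ : ℕ} (p : Fin (d₁ + d₂) → ℝ) : Fin d₂ → ℝ := fun j => p (Fin.natAdd d₁ j)

/-- λ₁ = L₁₁^{-T} L₁₁^{-1} p₁. -/
noncomputable def lam1 {d₁ d₂ : ℕ} (L : Matrix (Fin (d₁ + d₂)) (Fin (d₁ + d₂)) ℝ)
    (p : Fin (d₁ + d₂) → ℝ) : Fin d₁ → ℝ :=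
  ((blk11 L)⁻¹)ᵀ.mulVec ((blk11 L)⁻¹.mulVec (vec1 p))

/-- q = L₂₁ L₁₁^{-1} p₁ − p₂. -/
noncomputable def qvec {d₁ d₂ : ℕ} (L : Matrix (Fin (d₁ + d₂)) (Fin (d₁ + d₂)) ℝ)
    (p : Fin (d₁ + d₂) → ℝ) : Fin d₂ → ℝ :=
  fun j => (blk21 L).mulVec ((blk11 L)⁻¹.mulVec (vec1 p)) j - vec2 p j

/-- The feasible set / region of integration 𝒞_γ = {x : Lx ≥ γp}. -/
def Cgam {d : ℕ} (L : Matrix (Fin d) (Fin d) ℝ) (p : Fin d → ℝ) (γ : ℝ) :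
    Set (Fin d → ℝ) := {x | ∀ i, γ * p i ≤ L.mulVec x i}

/-- ℓ(γ) = P(LZ ≥ γp) = ∫_{𝒞_γ} φ_d(x) dx. -/
noncomputable def ellGam {d : ℕ} (L : Matrix (Fin d) (Fin d) ℝ) (p : Fin d → ℝ) (γ : ℝ) : ℝ :=
  ∫ x in Cgam L p γ, phiD x

/-- One-sided sequential bound l̃ᵧ_k(x) = (γ p_k − Σ_{j<k} L_{kj} x_j)/L_{kk}. -/
noncomputable def lTilGam {d : ℕ} (L : Matrix (Fin d) (Fin d) ℝ) (p : Fin d → ℝ) (γ : ℝ)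
    (x : Fin d → ℝ) (k : Fin d) : ℝ :=
  (γ * p k - ∑ j ∈ Finset.Iio k, L k j * x j) / L k k

/-- ψ_γ(x;μ) = −xᵀμ + ‖μ‖²/2 + Σ_k log(1 − Φ(l̃ᵧ_k(x) − μ_k)). -/
noncomputable def psiGam {d : ℕ} (L : Matrix (Fin d) (Fin d) ℝ) (p : Fin d → ℝ) (γ : ℝ)
    (x μ : Fin d → ℝ) : ℝ :=
  -(∑ i, x i * μ i) + (∑ i, μ i ^ 2) / 2 +
    ∑ k, Real.log (1 - Phi (lTilGam L p γ x k - μ k))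

/-- Second moment of the exponentially tilted estimator with tilting parameter μ(γ):
M(γ) = ∫_{𝒞_γ} exp(ψ_γ(x;μ(γ))) φ_d(x) dx. -/
noncomputable def Mgam {d : ℕ} (L : Matrix (Fin d) (Fin d) ℝ) (p : Fin d → ℝ)
    (μstar : ℝ → Fin d → ℝ) (γ : ℝ) : ℝ :=
  ∫ x in Cgam L p γ, Real.exp (psiGam L p γ x (μstar γ)) * phiD x

lemma stdPdf_eq_gaussianPDFReal : stdPdf = ProbabilityTheory.gaussianPDFReal 0 1 := by
  funext t
  simp [stdPdf, ProbabilityTheory.gaussianPDFReal]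

lemma stdPdf_pos (t : ℝ) : 0 < stdPdf t := by
  unfold stdPdf
  positivity

lemma integrable_stdPdf : Integrable stdPdf := by
  rw [stdPdf_eq_gaussianPDFReal]
  exact ProbabilityTheory.integrable_gaussianPDFReal 0 1

lemma one_sub_Phi_eq (t : ℝ) : 1 - Phi t = ∫ s in Set.Ioi t, stdPdf s := by
  have h := intervalIntegral.integral_Iic_add_Ioi (b := t)
    integrable_stdPdf.integrableOn integrable_stdPdf.integrableOn
  have h1 : ∫ s, stdPdf s = 1 := by
    rw [stdPdf_eq_gaussianPDFReal]
    exact ProbabilityTheory.integral_gaussianPDFReal_eq_one 0 one_ne_zero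
  rw [h1] at h
  unfold Phi
  linarith

lemma one_sub_Phi_pos (t : ℝ) : 0 < 1 - Phi t := by
  rw [one_sub_Phi_eq, setIntegral_pos_iff_support_of_nonneg_ae
    (ae_of_all _ fun s => (stdPdf_pos s).le) integrable_stdPdf.integrableOn]
  have h : Function.support stdPdf = Set.univ :=
    Set.eq_univ_of_forall fun s => (stdPdf_pos s).ne'
  simp [h]

lemma one_sub_Phi_le_one (t : ℝ) : 1 - Phi t ≤ 1 := by
  have : 0 ≤ Phi t := integral_nonneg fun s => (stdPdf_pos s).le
  linarith

/-- Chernoff-type bound for the normal tail, valid for every `t`. -/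
lemma one_sub_Phi_le_exp {τ : ℝ} (hτ : 0 < τ) (t : ℝ) :
    1 - Phi t ≤ (√(2 * π) * τ)⁻¹ * exp (τ ^ 2 / 2 - τ * t) := by
  have hint := (integrableOn_exp_mul_Ioi (neg_neg_of_pos hτ) t).const_mul
    ((√(2 * π))⁻¹ * exp (τ ^ 2 / 2))
  calc 1 - Phi t = ∫ s in Set.Ioi t, stdPdf s := one_sub_Phi_eq t
    _ ≤ ∫ s in Set.Ioi t, (√(2 * π))⁻¹ * exp (τ ^ 2 / 2) * exp (-τ * s) := by
      refine setIntegral_mono integrable_stdPdf.integrableOn hint fun s => ?_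
      unfold stdPdf
      rw [mul_assoc, ← exp_add]
      gcongr
      nlinarith [sq_nonneg (s - τ)]
    _ = (√(2 * π) * τ)⁻¹ * exp (τ ^ 2 / 2 - τ * t) := by
      rw [integral_const_mul, integral_exp_mul_Ioi (neg_neg_of_pos hτ), sub_eq_add_neg, exp_add,
        mul_inv, neg_div_neg_eq, neg_mul]
      ring

lemma log_one_sub_Phi_le {τ : ℝ} (hτ : 0 ≤ τ) (t : ℝ) :
    log (1 - Phi t) ≤ τ ^ 2 / 2 - τ * t + log (if 0 < τ then (√(2 * π) * τ)⁻¹ else 1) := by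
  split_ifs with h
  · have h0 : (√(2 * π) * τ)⁻¹ ≠ 0 := by positivity
    have := log_le_log (one_sub_Phi_pos t) (one_sub_Phi_le_exp h t)
    rw [log_mul h0 (exp_pos _).ne', log_exp] at this
    linarith
  · obtain rfl : τ = 0 := le_antisymm (not_lt.mp h) hτ
    simpa using log_nonpos (one_sub_Phi_pos t).le (one_sub_Phi_le_one t)

lemma mulVec_eq_sum_Iio_add {d : ℕ} {L : Matrix (Fin d) (Fin d) ℝ}
    (hLow : ∀ i j, i < j → L i j = 0) (x : Fin d → ℝ) (k : Fin d) :
    L.mulVec x k = ∑ j ∈ Finset.Iio k, L k j * x j + L k k * x k := by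
  have h : ∑ j ∈ Finset.Iic k, L k j * x j = ∑ j, L k j * x j := by
    refine Finset.sum_subset (Finset.subset_univ _) fun j _ hj => ?_
    rw [hLow k j (by simpa using hj), zero_mul]
  rw [← Finset.Iio_insert, Finset.sum_insert (by simp)] at h
  simp only [mulVec, dotProduct, ← h]
  ring

/-- For a suitable tilting vector, `ψ` is bounded above on the whole space by the logarithm of
the large-deviations rate, up to a polynomial factor. -/
lemma psiGam_le {d : ℕ} {L : Matrix (Fin d) (Fin d) ℝ} (hLow : ∀ i j, i < j → L i j = 0)
    (hDiag : ∀ i, 0 < L i i) {p l a : Fin d → ℝ} (hl : ∀ k, 0 ≤ l k)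
    (hla : ∀ j, ∑ k, l k * L k j = a j) (hlp : ∑ k, l k * p k = ∑ k, a k ^ 2)
    {γ : ℝ} (hγ : 0 < γ) (x : Fin d → ℝ) :
    psiGam L p γ x (fun k => γ * a k - γ * L k k * l k) ≤
      -(γ ^ 2 * ∑ k, a k ^ 2) / 2 +
        ∑ k, log (if 0 < γ * L k k * l k then (√(2 * π) * (γ * L k k * l k))⁻¹ else 1) := by
  set τ : Fin d → ℝ := fun k => γ * L k k * l k with hτ
  have hτ0 : ∀ k, 0 ≤ τ k := fun k => mul_nonneg (mul_pos hγ (hDiag k)).le (hl k)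
  have hlog := Finset.sum_le_sum fun k (_ : k ∈ Finset.univ) =>
    log_one_sub_Phi_le (hτ0 k) (lTilGam L p γ x k - (γ * a k - τ k))
  have hlx : ∑ k, l k * L.mulVec x k = ∑ k, a k * x k := by
    simp only [mulVec, dotProduct, Finset.mul_sum, ← hla, Finset.sum_mul]
    rw [Finset.sum_comm]
    simp only [mul_assoc]
  have hτl : ∀ k, τ k * lTilGam L p γ x k =
      γ ^ 2 * (l k * p k) - γ * (l k * L.mulVec x k) + τ k * x k := fun k => by
    rw [mulVec_eq_sum_Iio_add hLow, lTilGam, hτ]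
    field_simp [(hDiag k).ne']
    ring
  have hsum : ∑ k, τ k * lTilGam L p γ x k =
      γ ^ 2 * ∑ k, a k ^ 2 - γ * ∑ k, a k * x k + ∑ k, τ k * x k := by
    simp only [hτl, Finset.sum_add_distrib, Finset.sum_sub_distrib, ← Finset.mul_sum, hlx, hlp]
  have key : -(∑ k, x k * (γ * a k - τ k)) + (∑ k, (γ * a k - τ k) ^ 2) / 2 +
      ∑ k, (τ k ^ 2 / 2 - τ k * (lTilGam L p γ x k - (γ * a k - τ k))) =
      -(γ ^ 2 * ∑ k, a k ^ 2) / 2 := by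
    have e : ∀ k, τ k ^ 2 / 2 - τ k * (lTilGam L p γ x k - (γ * a k - τ k)) =
      -(τ k * lTilGam L p γ x k) + (-(τ k ^ 2) / 2 + τ k * γ * a k) := fun k => by ring
    simp only [e, Finset.sum_add_distrib, Finset.sum_neg_distrib, hsum]
    simp only [Finset.mul_sum, Finset.sum_div, ← Finset.sum_neg_distrib,
      ← Finset.sum_add_distrib, ← Finset.sum_sub_distrib]
    rw [← sub_eq_zero]
    simp only [neg_div, ← Finset.sum_sub_distrib]
    exact Finset.sum_eq_zero fun k _ => by ring
  rw [Finset.sum_add_distrib] at hlog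
  unfold psiGam
  linarith

lemma integrable_phiD {d : ℕ} : Integrable (phiD (d := d)) := by
  have h : (phiD (d := d)) = fun x => ∏ i, stdPdf (x i) := by
    funext x
    simp only [phiD, stdPdf, Finset.prod_mul_distrib, Finset.prod_const, Finset.card_univ,
      Fintype.card_fin, inv_pow, ← exp_sum, neg_div, Finset.sum_neg_distrib, Finset.sum_div]
  rw [h]
  exact Integrable.fintype_prod fun _ => integrable_stdPdf

lemma phiD_pos {d : ℕ} (x : Fin d → ℝ) : 0 < phiD x := by
  unfold phiD
  positivity

lemma measurableSet_Cgam {d : ℕ} (L : Matrix (Fin d) (Fin d) ℝ) (p : Fin d → ℝ) (γ : ℝ) :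
    MeasurableSet (Cgam L p γ) := by
  have : Cgam L p γ = ⋂ i, {x | γ * p i ≤ L.mulVec x i} := by
    ext x
    simp [Cgam]
  rw [this]
  refine MeasurableSet.iInter fun i => measurableSet_le measurable_const ?_
  unfold mulVec dotProduct
  fun_prop

/-- A minimax tilting does at least as well as any tilting with a negative supremum. -/
lemma Mgam_le_of_psiGam_le {d : ℕ} {L : Matrix (Fin d) (Fin d) ℝ} {p : Fin d → ℝ}
    {μstar : ℝ → Fin d → ℝ} {γ : ℝ}
    (hmin : ∀ μ : Fin d → ℝ,
      sSup ((fun x => psiGam L p γ x (μstar γ)) '' Cgam L p γ) ≤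
        sSup ((fun x => psiGam L p γ x μ) '' Cgam L p γ))
    {μ : Fin d → ℝ} {B : ℝ} (hB : B < 0) (hμ : ∀ x, psiGam L p γ x μ ≤ B) :
    Mgam L p μstar γ ≤ exp B * ellGam L p γ := by
  have hstar : ∀ x ∈ Cgam L p γ, psiGam L p γ x (μstar γ) ≤ B := fun x hx => by
    have h : sSup ((fun x => psiGam L p γ x (μstar γ)) '' Cgam L p γ) ≤ B := by
      refine (hmin μ).trans (csSup_le ⟨_, Set.mem_image_of_mem _ hx⟩ ?_)
      rintro _ ⟨y, -, rfl⟩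
      exact hμ y
    by_cases hb : BddAbove ((fun x => psiGam L p γ x (μstar γ)) '' Cgam L p γ)
    · exact (le_csSup hb (Set.mem_image_of_mem _ hx)).trans h
    · rw [Real.sSup_of_not_bddAbove hb] at h
      exact absurd h (not_le.mpr hB)
  unfold Mgam ellGam
  rw [← integral_const_mul]
  refine integral_mono_of_nonneg (ae_of_all _ fun x => ?_)
    (integrable_phiD.integrableOn.const_mul _) ?_
  · exact mul_nonneg (exp_pos _).le (phiD_pos x).le
  · filter_upwards [ae_restrict_mem (measurableSet_Cgam L p γ)] with x hx
    exact mul_le_mul_of_nonneg_right (exp_le_exp.mpr (hstar x hx)) (phiD_pos x).le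

lemma exists_sum_abs_mul_le {d : ℕ} {L : Matrix (Fin d) (Fin d) ℝ} (hDiag : ∀ i, 0 < L i i) :
    ∃ u : Fin d → ℝ, (∀ k, 0 ≤ u k) ∧
      ∀ k, ∑ j ∈ Finset.Iio k, |L k j| * (u j + 1) ≤ L k k * u k := by
  have hterm : ∀ k, 0 ≤ ∑ j, 2 * |L k j| / L k k := fun k =>
    Finset.sum_nonneg fun j _ => div_nonneg (by positivity) (hDiag k).le
  set R : ℝ := 1 + ∑ k, ∑ j, 2 * |L k j| / L k k with hR
  have hR1 : 1 ≤ R := by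
    have : 0 ≤ ∑ k, ∑ j, 2 * |L k j| / L k k := Finset.sum_nonneg fun k _ => hterm k
    linarith
  refine ⟨fun k => R ^ (k.val + 1), fun k => by positivity, fun k => ?_⟩
  have hk : ∑ j, 2 * |L k j| ≤ L k k * R := by
    have h1 : ∑ j, 2 * |L k j| / L k k ≤ R :=
      (Finset.single_le_sum (f := fun k => ∑ j, 2 * |L k j| / L k k) (fun k _ => hterm k)
        (Finset.mem_univ k)).trans (by linarith)
    rwa [← Finset.sum_div, div_le_iff₀ (hDiag k), mul_comm] at h1
  calc ∑ j ∈ Finset.Iio k, |L k j| * (R ^ (j.val + 1) + 1)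
      ≤ ∑ j ∈ Finset.Iio k, 2 * |L k j| * R ^ k.val := by
        refine Finset.sum_le_sum fun j hj => ?_
        have h1 : R ^ (j.val + 1) ≤ R ^ k.val :=
          pow_le_pow_right₀ hR1 (Finset.mem_Iio.mp hj)
        have h2 : 1 ≤ R ^ k.val := one_le_pow₀ hR1
        nlinarith [abs_nonneg (L k j)]
    _ ≤ ∑ j, 2 * |L k j| * R ^ k.val :=
        Finset.sum_le_sum_of_subset_of_nonneg (Finset.subset_univ _)
          fun j _ _ => by positivity
    _ = (∑ j, 2 * |L k j|) * R ^ k.val := by rw [Finset.sum_mul]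
    _ ≤ L k k * R * R ^ k.val := by gcongr
    _ = L k k * R ^ (k.val + 1) := by ring

/-- Lower bound for `ℓ(γ)`, obtained by integrating over a box in `𝒞_γ` near `γ a`. -/
lemma exists_le_ellGam {d : ℕ} {L : Matrix (Fin d) (Fin d) ℝ} (hLow : ∀ i j, i < j → L i j = 0)
    (hDiag : ∀ i, 0 < L i i) {p l a : Fin d → ℝ} (hl : ∀ j k, j ≤ k → 0 < l k → 0 < l j)
    (hla : ∀ k, ¬ 0 < l k → a k = 0) (hpa : ∀ k, p k ≤ L.mulVec a k) :
    ∃ c : ℝ, 0 < c ∧ ∀ γ : ℝ, 1 ≤ γ →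
      c * (∏ k, if 0 < l k then γ⁻¹ else 1) * exp (-(γ ^ 2 * ∑ k, a k ^ 2) / 2) ≤
        ellGam L p γ := by
  obtain ⟨u, hu0, hu⟩ := exists_sum_abs_mul_le hDiag
  set D : ℝ := ∑ k, (2 * (|a k| * (u k + 1)) + (u k + 1) ^ 2) with hD
  refine ⟨((√(2 * π)) ^ d)⁻¹ * exp (-D / 2), by positivity, fun γ hγ => ?_⟩
  have hγ0 : 0 < γ := one_pos.trans_le hγ
  set s : Fin d → ℝ := fun k => if 0 < l k then γ⁻¹ else 1 with hs
  have hs0 : ∀ k, 0 < s k := fun k => by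
    simp only [hs]
    split_ifs <;> positivity
  have hs1 : ∀ k, s k ≤ 1 := fun k => by
    simp only [hs]
    split_ifs
    exacts [inv_le_one_of_one_le₀ hγ, le_rfl]
  have hsmono : ∀ j k, j ≤ k → s j ≤ s k := fun j k hjk => by
    by_cases hk : 0 < l k
    · simp [hs, hk, hl j k hjk hk]
    · simpa [hs, hk] using hs1 j
  set lo : Fin d → ℝ := fun k => γ * a k + s k * u k with hlo
  set hi : Fin d → ℝ := fun k => γ * a k + s k * (u k + 1) with hhi
  have hlohi : lo ≤ hi := fun k => by
    simp only [hlo, hhi]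
    nlinarith [hs0 k]
  have hvol : volume.real (Set.Icc lo hi) = ∏ k, s k := by
    rw [Measure.real, Real.volume_Icc_pi_toReal hlohi]
    exact Finset.prod_congr rfl fun k _ => by simp only [hlo, hhi]; ring
  have hsub : Set.Icc lo hi ⊆ Cgam L p γ := fun x hx k => by
    set v : Fin d → ℝ := x - γ • a with hv
    have hv1 : ∀ j, s j * u j ≤ v j := fun j => by
      have := hx.1 j
      simp only [hlo] at this
      simp only [hv, Pi.sub_apply, Pi.smul_apply, smul_eq_mul]
      linarith
    have hv2 : ∀ j, v j ≤ s j * (u j + 1) := fun j => by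
      have := hx.2 j
      simp only [hhi] at this
      simp only [hv, Pi.sub_apply, Pi.smul_apply, smul_eq_mul]
      linarith
    have hLv : 0 ≤ L.mulVec v k := by
      rw [mulVec_eq_sum_Iio_add hLow]
      have h1 : ∑ j ∈ Finset.Iio k, -(s k * (|L k j| * (u j + 1))) ≤
          ∑ j ∈ Finset.Iio k, L k j * v j := by
        refine Finset.sum_le_sum fun j hj => ?_
        have hv0 : 0 ≤ v j := (mul_nonneg (hs0 j).le (hu0 j)).trans (hv1 j)
        have hvk : v j ≤ s k * (u j + 1) := (hv2 j).trans <|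
          mul_le_mul_of_nonneg_right (hsmono j k (Finset.mem_Iio.mp hj).le)
            (by linarith [hu0 j])
        have h2 := mul_le_mul_of_nonneg_left hvk (abs_nonneg (L k j))
        have h3 := mul_le_mul_of_nonneg_right (neg_abs_le (L k j)) hv0
        linarith
      rw [Finset.sum_neg_distrib, ← Finset.mul_sum] at h1
      have h4 := mul_le_mul_of_nonneg_left (hu k) (hs0 k).le
      have h5 := mul_le_mul_of_nonneg_left (hv1 k) (hDiag k).le
      linarith
    have hLx : L.mulVec v k = L.mulVec x k - γ * L.mulVec a k := by
      rw [hv, mulVec_sub, mulVec_smul]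
      rfl
    have := mul_le_mul_of_nonneg_left (hpa k) hγ0.le
    linarith
  have hphi : ∀ x ∈ Set.Icc lo hi,
      ((√(2 * π)) ^ d)⁻¹ * exp (-D / 2) * exp (-(γ ^ 2 * ∑ k, a k ^ 2) / 2) ≤ phiD x := by
    intro x hx
    have hsq : ∑ k, x k ^ 2 ≤ γ ^ 2 * ∑ k, a k ^ 2 + D := by
      rw [hD, Finset.mul_sum, ← Finset.sum_add_distrib]
      refine Finset.sum_le_sum fun k _ => ?_
      have h1 := hx.1 k
      have h2 := hx.2 k
      simp only [hlo] at h1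
      simp only [hhi] at h2
      obtain ⟨v, hv⟩ : ∃ v, x k = γ * a k + v := ⟨x k - γ * a k, by ring⟩
      rw [hv] at h1 h2 ⊢
      have hu1 : 0 ≤ u k + 1 := by linarith [hu0 k]
      have hv0 : 0 ≤ v := by linarith [mul_nonneg (hs0 k).le (hu0 k)]
      have hv1 : v ≤ u k + 1 := by linarith [mul_le_mul_of_nonneg_right (hs1 k) hu1]
      have hva : γ * a k * v ≤ |a k| * (u k + 1) := by
        by_cases hk : 0 < l k
        · have h3 : γ * v ≤ u k + 1 := by
            have h4 : v ≤ γ⁻¹ * (u k + 1) := by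
              simp only [hs, hk, if_true] at h2
              linarith
            rwa [inv_mul_eq_div, le_div_iff₀ hγ0, mul_comm] at h4
          calc γ * a k * v = a k * (γ * v) := by ring
            _ ≤ |a k| * (γ * v) := by
              gcongr
              exact le_abs_self _
            _ ≤ |a k| * (u k + 1) := by gcongr
        · simp [hla k hk]
      nlinarith
    rw [mul_assoc, ← exp_add]
    unfold phiD
    gcongr
    linarith
  calc ((√(2 * π)) ^ d)⁻¹ * exp (-D / 2) * (∏ k, s k) * exp (-(γ ^ 2 * ∑ k, a k ^ 2) / 2)
      = ((√(2 * π)) ^ d)⁻¹ * exp (-D / 2) * exp (-(γ ^ 2 * ∑ k, a k ^ 2) / 2) *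
          volume.real (Set.Icc lo hi) := by rw [hvol]; ring
    _ ≤ ∫ x in Set.Icc lo hi, phiD x :=
        setIntegral_ge_of_const_le_real measurableSet_Icc isCompact_Icc.measure_ne_top hphi
          integrable_phiD.integrableOn
    _ ≤ ellGam L p γ :=
        setIntegral_mono_set integrable_phiD.integrableOn
          (ae_of_all _ fun x => (phiD_pos x).le) (LE.le.eventuallyLE hsub)

/-- Bounded relative error from a multiplier `l ≥ 0` and a boundary point `a = Lᵀ l` satisfying
complementary slackness, where the support of `l` is an initial segment of the coordinates. -/
lemma isBoundedUnder_Mgam_div_ellGam_sq {d : ℕ} {L : Matrix (Fin d) (Fin d) ℝ}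
    (hLow : ∀ i j, i < j → L i j = 0) (hDiag : ∀ i, 0 < L i i) {p l a : Fin d → ℝ}
    (hl0 : ∀ k, 0 ≤ l k) (hl : ∀ j k, j ≤ k → 0 < l k → 0 < l j)
    (hal : ∀ j, ∑ k, l k * L k j = a j) (hla : ∀ k, ¬ 0 < l k → a k = 0)
    (hlp : ∑ k, l k * p k = ∑ k, a k ^ 2) (hlp0 : 0 < ∑ k, l k * p k)
    (hpa : ∀ k, p k ≤ L.mulVec a k) {μstar : ℝ → Fin d → ℝ}
    (hmin : ∀ γ : ℝ, 0 < γ → ∀ μ : Fin d → ℝ,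
      sSup ((fun x => psiGam L p γ x (μstar γ)) '' Cgam L p γ) ≤
        sSup ((fun x => psiGam L p γ x μ) '' Cgam L p γ)) :
    IsBoundedUnder (· ≤ ·) atTop
      (fun γ : ℝ => Mgam L p μstar γ / (ellGam L p γ) ^ 2) := by
  obtain ⟨c, hc, hell⟩ := exists_le_ellGam hLow hDiag hl hla hpa
  set κ : Fin d → ℝ := fun k => if 0 < l k then (√(2 * π) * (L k k * l k))⁻¹ else 1 with hκ
  have hκ0 : ∀ k, 0 < κ k := fun k => by
    simp only [hκ]
    split_ifs with h
    · have := hDiag k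
      positivity
    · exact one_pos
  have hlarge : ∀ᶠ γ : ℝ in atTop, 1 ≤ γ ∧ ∀ k, κ k ≤ γ := by
    refine (eventually_ge_atTop 1).and ?_
    rw [eventually_all]
    exact fun k => eventually_ge_atTop _
  refine ⟨(∏ k, κ k) / c, ?_⟩
  rw [eventually_map]
  filter_upwards [hlarge] with γ ⟨hγ1, hγκ⟩
  have hγ : 0 < γ := one_pos.trans_le hγ1
  set s : Fin d → ℝ := fun k => if 0 < l k then γ⁻¹ else 1 with hs
  have hs0 : ∀ k, 0 < s k := fun k => by
    simp only [hs]
    split_ifs <;> positivity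
  set A : ℝ := exp (-(γ ^ 2 * ∑ k, a k ^ 2) / 2) with hA
  set B : ℝ := -(γ ^ 2 * ∑ k, a k ^ 2) / 2 + ∑ k, log (s k * κ k) with hB
  have hψ : ∀ x, psiGam L p γ x (fun k => γ * a k - γ * L k k * l k) ≤ B := fun x => by
    refine (psiGam_le hLow hDiag hl0 hal hlp hγ x).trans_eq ?_
    congr 1
    refine Finset.sum_congr rfl fun k _ => congrArg log ?_
    have h : 0 < γ * L k k * l k ↔ 0 < l k := mul_pos_iff_of_pos_left (mul_pos hγ (hDiag k))
    simp only [h, hs, hκ]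
    split_ifs
    · rw [← mul_inv]
      congr 1
      ring
    · simp
  have hBneg : B < 0 := by
    have h1 : ∑ k, log (s k * κ k) ≤ 0 := by
      refine Finset.sum_nonpos fun k _ => ?_
      refine log_nonpos (mul_pos (hs0 k) (hκ0 k)).le ?_
      by_cases hk : 0 < l k
      · simp only [hs, hk, if_true]
        rw [inv_mul_le_iff₀ hγ, mul_one]
        exact hγκ k
      · simp [hs, hκ, hk]
    have h2 : 0 < γ ^ 2 * ∑ k, a k ^ 2 := mul_pos (by positivity) (hlp ▸ hlp0)
    linarith
  have hexpB : exp B = A * ((∏ k, s k) * ∏ k, κ k) := by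
    rw [hB, exp_add, exp_sum, ← Finset.prod_mul_distrib]
    congr 1
    exact Finset.prod_congr rfl fun k _ => exp_log (mul_pos (hs0 k) (hκ0 k))
  have hM := Mgam_le_of_psiGam_le (hmin γ hγ) hBneg hψ
  have hE := hell γ hγ1
  have hP : 0 < ∏ k, s k := Finset.prod_pos fun k _ => hs0 k
  have hE0 : 0 < ellGam L p γ := lt_of_lt_of_le (by positivity) hE
  have hK : 0 < ∏ k, κ k := Finset.prod_pos fun k _ => hκ0 k
  rw [div_le_div_iff₀ (by positivity) hc]
  calc Mgam L p μstar γ * c ≤ exp B * ellGam L p γ * c := by gcongr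
    _ = (∏ k, κ k) * (c * (∏ k, s k) * A) * ellGam L p γ := by rw [hexpB]; ring
    _ ≤ (∏ k, κ k) * ellGam L p γ * ellGam L p γ := by gcongr
    _ = (∏ k, κ k) * ellGam L p γ ^ 2 := by ring

/-- Theorem 2, case 𝒥 ≠ ∅: if q_j = 0 for some j then the minimax
exponentially tilted estimator has bounded relative error:
limsup_{γ→∞} M(γ)/ℓ(γ)² < ∞. -/
theorem minimax_bounded_relative_error {d₁ d₂ : ℕ} (hd₁ : 1 ≤ d₁)
    (L : Matrix (Fin (d₁ + d₂)) (Fin (d₁ + d₂)) ℝ)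
    (hLow : ∀ i j : Fin (d₁ + d₂), i < j → L i j = 0)
    (hDiag : ∀ i, 0 < L i i)
    (p : Fin (d₁ + d₂) → ℝ) (hp : ∀ i, 0 < p i)
    (hlam : ∀ i, 0 < lam1 L p i)
    (hq : ∀ j, 0 ≤ qvec L p j)
    (hqzero : ∃ j, qvec L p j = 0)
    (μstar : ℝ → Fin (d₁ + d₂) → ℝ)
    (hmin : ∀ γ : ℝ, 0 < γ → ∀ μ : Fin (d₁ + d₂) → ℝ,
      sSup ((fun x => psiGam L p γ x (μstar γ)) '' Cgam L p γ) ≤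
        sSup ((fun x => psiGam L p γ x μ) '' Cgam L p γ)) :
    IsBoundedUnder (· ≤ ·) atTop
      (fun γ : ℝ => Mgam L p μstar γ / (ellGam L p γ) ^ 2) := by
  set b : Fin d₁ → ℝ := (blk11 L)⁻¹.mulVec (vec1 p) with hb
  have hdet : IsUnit (blk11 L).det := by
    have hT : (blk11 L).BlockTriangular OrderDual.toDual := fun i j hij =>
      hLow _ _ (by rw [Fin.lt_def]; simpa using! hij)
    rw [det_of_isLowerTriangular _ hT]
    exact (Finset.prod_pos fun i _ => hDiag _).ne'.isUnit
  have hLb : (blk11 L).mulVec b = vec1 p := by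
    rw [hb, mulVec_mulVec, mul_nonsing_inv _ hdet, one_mulVec]
  have hlamL : ∀ j, ∑ k, lam1 L p k * blk11 L k j = b j := fun j => by
    have h : (blk11 L)ᵀ.mulVec (lam1 L p) = b := by
      rw [lam1, mulVec_mulVec, ← transpose_mul, nonsing_inv_mul _ hdet, transpose_one, one_mulVec]
    rw [← h]
    exact Finset.sum_congr rfl fun k _ => mul_comm _ _
  have hlamp : ∑ k, lam1 L p k * vec1 p k = ∑ k, b k ^ 2 := by
    simp only [← hLb, mulVec, dotProduct, Finset.mul_sum, ← mul_assoc]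
    rw [Finset.sum_comm]
    simp only [← Finset.sum_mul, hlamL, sq]
  have hcross : ∀ (i : Fin d₁) (j : Fin d₂), L (Fin.castAdd d₂ i) (Fin.natAdd d₁ j) = 0 :=
    fun i j => hLow _ _ (by rw [Fin.lt_def]; simp; omega)
  refine isBoundedUnder_Mgam_div_ellGam_sq hLow hDiag
    (l := Fin.append (lam1 L p) 0) (a := Fin.append b 0) ?_ ?_ ?_ ?_ ?_ ?_ ?_ hmin
  · refine Fin.addCases (fun i => ?_) fun j => ?_
    · simpa using (hlam i).le
    · simp
  · intro j k hjk hk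
    induction j using Fin.addCases with
    | left i => simpa using hlam i
    | right j =>
      induction k using Fin.addCases with
      | left i =>
        rw [Fin.le_def] at hjk
        simp at hjk
        omega
      | right k => simp at hk
  · refine Fin.addCases (fun i => ?_) fun j => ?_
    · simpa [Fin.sum_univ_add, blk11] using hlamL i
    · simp [Fin.sum_univ_add, hcross]
  · refine Fin.addCases (fun i h => ?_) fun j _ => ?_
    · exact absurd (by simpa using hlam i) h
    · simp
  · simpa [Fin.sum_univ_add, vec1] using hlamp
  · simp only [Fin.sum_univ_add, Fin.append_left, Fin.append_right, Pi.zero_apply, zero_mul,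
      Finset.sum_const_zero, add_zero]
    exact Finset.sum_pos (fun i _ => mul_pos (hlam i) (hp _)) ⟨⟨0, hd₁⟩, Finset.mem_univ _⟩
  · refine Fin.addCases (fun i => ?_) fun j => ?_
    · refine (congrFun hLb i).symm.le.trans_eq ?_
      simp [mulVec, dotProduct, Fin.sum_univ_add, blk11]
    · have h := hq j
      rw [qvec, ← hb, sub_nonneg] at h
      refine h.trans_eq ?_
      simp [mulVec, dotProduct, Fin.sum_univ_add, blk21]
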